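/- Let f : ℝ → ℂ be smooth (C^∞). For q ≥ 1 define the confluent divided difference D_q f : ℝ^{q+1} → ℂ by the Genocchi–Hermite integral D_q f(x₀,…,x_q) := ∫_{Δ_q} f^{(q)}((1−t₁)x₀ + (t₁−t₂)x₁ + ⋯ + t_q x_q) dt₁⋯dt_q, where Δ_q := {0 ≤ t_q ≤ ⋯ ≤ t₁ ≤ 1}. Let n ≥ 1, let x₀,…,xₙ ∈ ℝ be pairwise distinct, and let α = (α₀,…,αₙ) ∈ ℕ^{n+1} be a multiindex with |α| = Σ α_j. Let u ∈ ℝ^{|α|+n+1} be the tuple consisting of α₀+1 copies of x₀ followed by α₁+1 copies of x₁, …, followed by αₙ+1 copies of xₙ. Then D_{|α|+n} f (u) = (1/α!) · ∂^α_x ( D_n f (x₀,…,xₙ) ), where ∂^α_x = ∂_{x₀}^{α₀} ⋯ ∂_{xₙ}^{αₙ} and α! = α₀!⋯αₙ!. -/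

import Mathlib

open MeasureTheory

/-- The standard ordered simplex `Δ_q = {0 ≤ t_q ≤ ⋯ ≤ t₁ ≤ 1} ⊆ ℝ^q`. -/
def orderedSimplex (q : ℕ) : Set (Fin q → ℝ) :=
  {t | Antitone t ∧ ∀ i, t i ∈ Set.Icc (0:ℝ) 1}

/-- The confluent divided difference `D_q f (x₀,…,x_q)` defined by the Genocchi–Hermite integral
`∫_{Δ_q} f^{(q)}((1−t₁)x₀ + (t₁−t₂)x₁ + ⋯ + t_q x_q) dt`; the barycentric coefficients are the
successive differences of the tuple `(1, t₁, …, t_q, 0)`. -/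
noncomputable def GHdd (q : ℕ) (f : ℝ → ℂ) (x : Fin (q+1) → ℝ) : ℂ :=
  ∫ t in orderedSimplex q, iteratedDeriv q f
    (∑ k : Fin (q+1),
      ((Fin.snoc (Fin.cons 1 t) 0 : Fin (q+2) → ℝ) k.castSucc
        - (Fin.snoc (Fin.cons 1 t) 0 : Fin (q+2) → ℝ) k.succ) * x k)

/-- The partial derivative `∂ᵢ` of a function `(Fin q → ℝ) → ℂ`. -/
noncomputable def pderiv' {q : ℕ} (i : Fin q) (g : (Fin q → ℝ) → ℂ) : (Fin q → ℝ) → ℂ :=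
  fun x => fderiv ℝ g x (Pi.single i 1)

/-- The iterated partial derivative `∂^α` with multiindex `α`. -/
noncomputable def mderiv' {q : ℕ} (α : Fin q → ℕ) (g : (Fin q → ℝ) → ℂ) : (Fin q → ℝ) → ℂ :=
  ((List.ofFn (fun i : Fin q => (pderiv' i)^[α i])).foldr (· ∘ ·) id) g

/-- The tuple `(1, t₁, …, t_q, 0)`. -/
def simplexTuple {q : ℕ} (t : Fin q → ℝ) : Fin (q + 2) → ℝ := Fin.snoc (Fin.cons 1 t) 0

/-- The point with barycentric coordinates given by the successive differences of
`(1, t₁, …, t_q, 0)` with respect to the nodes `x`. -/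
def simplexPoint {q : ℕ} (x : Fin (q + 1) → ℝ) (t : Fin q → ℝ) : ℝ :=
  ∑ k : Fin (q + 1), (simplexTuple t k.castSucc - simplexTuple t k.succ) * x k

theorem GHdd_eq_setIntegral (q : ℕ) (f : ℝ → ℂ) (x : Fin (q + 1) → ℝ) :
    GHdd q f x = ∫ t in orderedSimplex q, iteratedDeriv q f (simplexPoint x t) := rfl

@[simp] theorem simplexTuple_zero {q : ℕ} (t : Fin q → ℝ) : simplexTuple t 0 = 1 := by
  have : (0 : Fin (q + 2)) = Fin.castSucc 0 := rfl
  rw [simplexTuple, this, Fin.snoc_castSucc, Fin.cons_zero]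

@[simp] theorem simplexTuple_last {q : ℕ} (t : Fin q → ℝ) :
    simplexTuple t (Fin.last (q + 1)) = 0 := by
  rw [simplexTuple, Fin.snoc_last]

@[simp] theorem simplexTuple_castSucc_succ {q : ℕ} (t : Fin q → ℝ) (i : Fin q) :
    simplexTuple t i.castSucc.succ = t i := by
  rw [simplexTuple, Fin.succ_castSucc, Fin.snoc_castSucc, Fin.cons_succ]

theorem mem_orderedSimplex_iff {q : ℕ} (t : Fin q → ℝ) :
    t ∈ orderedSimplex q ↔ Antitone (simplexTuple t) := by
  constructor
  · rintro ⟨ht, h01⟩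
    intro i j hij
    induction j using Fin.lastCases with
    | last =>
      rw [simplexTuple_last]
      induction i using Fin.lastCases with
      | last => simp
      | cast i =>
        induction i using Fin.cases with
        | zero => simp
        | succ i => simpa using (h01 i).1
    | cast j =>
      induction i using Fin.lastCases with
      | last => exact absurd hij (not_le.2 (Fin.castSucc_lt_last j))
      | cast i =>
        have hij' : i ≤ j := by simpa using hij
        induction i using Fin.cases with
        | zero =>
          induction j using Fin.cases with
          | zero => simp
          | succ j => simpa using (h01 j).2
        | succ i =>
          induction j using Fin.cases with
          | zero => exact absurd hij' (not_le.2 (Fin.succ_pos i))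
          | succ j => simpa using ht (Fin.succ_le_succ_iff.1 hij')
  · intro h
    refine ⟨fun i j hij => ?_, fun i => ⟨?_, ?_⟩⟩
    · have := h (a := i.succ.castSucc) (b := j.succ.castSucc) (by simpa using hij)
      simpa using this
    · have := h (Fin.le_last i.succ.castSucc)
      simpa using this
    · have := h (Fin.zero_le i.succ.castSucc)
      simpa using this

theorem simplexTuple_insertNth {q : ℕ} (k : Fin (q + 1)) (s : ℝ) (t : Fin q → ℝ) :
    simplexTuple (k.insertNth s t : Fin (q + 1) → ℝ) =
      (k.succ.castSucc.insertNth s (simplexTuple t) : Fin (q + 3) → ℝ) := by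
  rw [Fin.eq_insertNth_iff]
  refine ⟨by simp, ?_⟩
  ext i
  rw [Fin.removeNth]
  induction i using Fin.lastCases with
  | last => simp
  | cast i =>
    rw [← Fin.succ_castSucc, Fin.succ_castSucc, Fin.castSucc_succAbove_castSucc]
    induction i using Fin.cases with
    | zero => simp
    | succ i => rw [Fin.succ_succAbove_succ]; simp

theorem antitone_insertNth_iff {m : ℕ} (k : Fin (m + 1)) (s : ℝ) (c : Fin (m + 2) → ℝ) :
    Antitone (k.succ.castSucc.insertNth s c : Fin (m + 3) → ℝ) ↔
      Antitone c ∧ s ∈ Set.Icc (c k.succ) (c k.castSucc) := by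
  set p : Fin (m + 3) := k.succ.castSucc with hp
  constructor
  · intro h
    refine ⟨fun i j hij => ?_, ?_, ?_⟩
    · simpa using h ((Fin.strictMono_succAbove p).monotone hij)
    · have := h (a := p) (b := p.succAbove k.succ) (by
        rw [hp, Fin.succAbove_castSucc_self]; exact Fin.castSucc_lt_succ.le)
      simpa using this
    · have := h (a := p.succAbove k.castSucc) (b := p) (by
        rw [hp, Fin.succAbove_castSucc_of_lt _ _ Fin.castSucc_lt_succ]
        exact Fin.castSucc_le_castSucc_iff.2 Fin.castSucc_lt_succ.le)
      simpa using this
  · rintro ⟨hc, h1, h2⟩ i j hij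
    induction i using Fin.succAboveCases p with
    | x =>
      induction j using Fin.succAboveCases p with
      | x => simp
      | p j =>
        have : k.succ ≤ j := by
          by_contra hlt
          rw [hp, Fin.succAbove_castSucc_of_lt _ _ (not_le.1 hlt)] at hij
          exact hlt (Fin.castSucc_lt_iff_succ_le.1 (by simpa using hij))
        simpa using (hc this).trans h1
    | p i =>
      induction j using Fin.succAboveCases p with
      | x =>
        have : i ≤ k.castSucc := by
          by_contra hlt
          have h' : k.succ ≤ i := by
            simp only [Fin.le_def, Fin.val_castSucc, Fin.val_succ] at hlt ⊢; omega
          rw [hp, Fin.succAbove_castSucc_of_le _ _ h'] at hij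
          simp only [Fin.le_def, Fin.val_castSucc, Fin.val_succ] at hij h' ; omega
        simpa using h2.trans (hc this)
      | p j => simpa using hc ((Fin.strictMono_succAbove p).le_iff_le.1 hij)

theorem simplexPoint_insertNth {q : ℕ} (k : Fin (q + 1)) (x : Fin (q + 1) → ℝ) (s : ℝ)
    (t : Fin q → ℝ) :
    simplexPoint (x ∘ k.predAbove) (k.insertNth s t : Fin (q + 1) → ℝ) = simplexPoint x t := by
  have hc (j : Fin (q + 2)) :
      simplexTuple (k.insertNth s t : Fin (q + 1) → ℝ) (k.succ.castSucc.succAbove j) =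
        simplexTuple t j := by
    rw [simplexTuple_insertNth, Fin.insertNth_apply_succAbove]
  have hs : simplexTuple (k.insertNth s t : Fin (q + 1) → ℝ) k.succ.castSucc = s := by simp
  have hk : simplexTuple (k.insertNth s t : Fin (q + 1) → ℝ) k.castSucc.castSucc =
      simplexTuple t k.castSucc := by
    rw [← hc, Fin.succAbove_castSucc_of_lt _ _ Fin.castSucc_lt_succ]
  rw [simplexPoint, Fin.sum_univ_succAbove _ k.castSucc, simplexPoint,
    ← Finset.add_sum_erase _ _ (Finset.mem_univ k),
    ← Finset.add_sum_erase (a := k) _ _ (Finset.mem_univ k), ← add_assoc]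
  congr 1
  · simp only [Function.comp_apply, Fin.predAbove_succ_self, Fin.predAbove_castSucc_self,
      Fin.succAbove_castSucc_self]
    rw [hk, Fin.succ_castSucc, hs,
      show simplexTuple (k.insertNth s t : Fin (q + 1) → ℝ) k.succ.succ =
        simplexTuple t k.succ by rw [← hc, Fin.succAbove_castSucc_self]]
    ring
  · refine Finset.sum_congr rfl fun j hj => ?_
    have hjk : j ≠ k := Finset.ne_of_mem_erase hj
    rw [Function.comp_apply, Fin.predAbove_succAbove]
    congr 1
    rcases lt_or_gt_of_ne hjk with h | h
    · have h' : j.castSucc < k.succ := (Fin.castSucc_lt_castSucc_iff.2 h).trans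
        Fin.castSucc_lt_succ
      rw [Fin.succAbove_castSucc_of_lt _ _ h, ← hc, ← hc,
        Fin.succAbove_castSucc_of_lt _ _ h',
        Fin.succAbove_castSucc_of_lt _ _ (Fin.succ_lt_succ_iff.2 h), Fin.succ_castSucc]
    · have h' : k.succ ≤ j.castSucc := by
        simp only [Fin.le_def, Fin.lt_def, Fin.val_castSucc, Fin.val_succ] at h ⊢; omega
      rw [Fin.succAbove_castSucc_of_le _ _ h.le, ← hc, ← hc,
        Fin.succAbove_castSucc_of_le _ _ h',
        Fin.succAbove_castSucc_of_le _ _ (Fin.succ_le_succ_iff.2 h.le), Fin.succ_castSucc]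

theorem isCompact_orderedSimplex (q : ℕ) : IsCompact (orderedSimplex q) := by
  refine (isCompact_univ_pi fun _ : Fin q => isCompact_Icc (a := (0 : ℝ)) (b := 1)).of_isClosed_subset
    ?_ fun t ht i _ => ht.2 i
  have : orderedSimplex q = {t | Antitone t} ∩ ⋂ i, (fun t => t i) ⁻¹' Set.Icc (0 : ℝ) 1 := by
    ext t
    simp [orderedSimplex]
  rw [this]
  refine isClosed_antitone.inter ?_
  exact isClosed_iInter fun i => isClosed_Icc.preimage (continuous_apply i)

theorem continuous_simplexTuple (q : ℕ) :
    Continuous (simplexTuple : (Fin q → ℝ) → Fin (q + 2) → ℝ) := by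
  refine continuous_pi fun i => ?_
  induction i using Fin.lastCases with
  | last => simpa using continuous_const
  | cast i =>
    induction i using Fin.cases with
    | zero => simpa using continuous_const
    | succ i => simpa using continuous_apply (A := fun _ => ℝ) i

theorem continuous_simplexPoint (q : ℕ) :
    Continuous fun p : (Fin (q + 1) → ℝ) × (Fin q → ℝ) => simplexPoint p.1 p.2 := by
  have h (i : Fin (q + 2)) : Continuous fun p : (Fin (q + 1) → ℝ) × (Fin q → ℝ) =>
      simplexTuple p.2 i :=
    (continuous_apply i).comp ((continuous_simplexTuple q).comp continuous_snd)
  refine continuous_finsetSum _ fun k _ => ((h _).sub (h _)).mul ?_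
  exact (continuous_apply k).comp continuous_fst

theorem setIntegral_orderedSimplex_succ {q : ℕ} (k : Fin (q + 1)) (x : Fin (q + 1) → ℝ)
    {g : ℝ → ℂ} (hg : Continuous g) :
    ∫ t in orderedSimplex (q + 1), g (simplexPoint (x ∘ k.predAbove) t) =
      ∫ t in orderedSimplex q,
        ((simplexTuple t k.castSucc - simplexTuple t k.succ : ℝ) : ℂ) * g (simplexPoint x t) := by
  set G : (Fin (q + 1) → ℝ) → ℂ := (orderedSimplex (q + 1)).indicator
    fun t => g (simplexPoint (x ∘ k.predAbove) t) with hG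
  have hmeas (m : ℕ) : MeasurableSet (orderedSimplex m) :=
    (isCompact_orderedSimplex m).isClosed.measurableSet
  have hGint : Integrable G := by
    rw [hG, integrable_indicator_iff (hmeas _)]
    refine ContinuousOn.integrableOn_compact (isCompact_orderedSimplex _)
      (Continuous.continuousOn ?_)
    exact hg.comp ((continuous_simplexPoint _).comp (continuous_const.prodMk continuous_id))
  have hmp := (volume_preserving_piFinSuccAbove (fun _ : Fin (q + 1) => ℝ) k).symm
  have hval (s : ℝ) (t : Fin q → ℝ) :
      G ((MeasurableEquiv.piFinSuccAbove (fun _ : Fin (q + 1) => ℝ) k).symm (s, t)) =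
      (orderedSimplex q).indicator (fun t => (Set.Icc (simplexTuple t k.succ)
        (simplexTuple t k.castSucc)).indicator (fun _ => g (simplexPoint x t)) s) t := by
    have : (MeasurableEquiv.piFinSuccAbove (fun _ : Fin (q + 1) => ℝ) k).symm (s, t) =
      (k.insertNth s t : Fin (q + 1) → ℝ) := rfl
    classical
    rw [this, hG]
    simp only [Set.indicator_apply, mem_orderedSimplex_iff, simplexPoint_insertNth,
      simplexTuple_insertNth, antitone_insertNth_iff, ite_and]
  rw [← integral_indicator (hmeas _), ← hG, ← hmp.integral_comp', Measure.volume_eq_prod,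
    integral_prod_symm _ (by
      rw [← Measure.volume_eq_prod]
      exact hmp.integrable_comp_of_integrable hGint),
    ← integral_indicator (hmeas _)]
  refine integral_congr_ae (Filter.Eventually.of_forall fun t => ?_)
  simp only [hval]
  by_cases ht : t ∈ orderedSimplex q
  · simp only [Set.indicator_of_mem ht]
    rw [integral_indicator measurableSet_Icc, setIntegral_const, Measure.real, Real.volume_Icc,
      ENNReal.toReal_ofReal, Complex.real_smul]
    exact sub_nonneg.2 ((mem_orderedSimplex_iff t).1 ht Fin.castSucc_lt_succ.le)
  · simp [Set.indicator_of_notMem ht]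

/-- The derivative of `simplexPoint` in the nodes. -/
def simplexPointCLM {q : ℕ} (t : Fin q → ℝ) : (Fin (q + 1) → ℝ) →L[ℝ] ℝ :=
  ∑ k : Fin (q + 1), (simplexTuple t k.castSucc - simplexTuple t k.succ) •
    ContinuousLinearMap.proj k

theorem simplexPointCLM_apply {q : ℕ} (t : Fin q → ℝ) (x : Fin (q + 1) → ℝ) :
    simplexPointCLM t x = simplexPoint x t := by
  simp [simplexPointCLM, simplexPoint]

theorem continuous_simplexPointCLM (q : ℕ) :
    Continuous (simplexPointCLM : (Fin q → ℝ) → (Fin (q + 1) → ℝ) →L[ℝ] ℝ) := by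
  refine continuous_finsetSum _ fun k _ => Continuous.fun_smul ?_ continuous_const
  exact ((continuous_apply _).comp (continuous_simplexTuple q)).sub
    ((continuous_apply _).comp (continuous_simplexTuple q))

theorem hasFDerivAt_comp_simplexPoint {q : ℕ} {g g' : ℝ → ℂ} (hg : ∀ u, HasDerivAt g (g' u) u)
    (t : Fin q → ℝ) (x : Fin (q + 1) → ℝ) :
    HasFDerivAt (fun y => g (simplexPoint y t))
      ((simplexPointCLM t).smulRight (g' (simplexPoint x t))) x := by
  simp only [← simplexPointCLM_apply]
  refine ((hg (simplexPointCLM t x)).hasFDerivAt.comp x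
    (simplexPointCLM t).hasFDerivAt).congr_fderiv ?_
  ext v
  simp

theorem continuous_smulRight_simplexPoint {q : ℕ} {g : ℝ → ℂ} (hg : Continuous g) :
    Continuous fun p : (Fin (q + 1) → ℝ) × (Fin q → ℝ) =>
      (simplexPointCLM p.2).smulRight (g (simplexPoint p.1 p.2)) :=
  ((ContinuousLinearMap.smulRightL ℝ (Fin (q + 1) → ℝ) ℂ).continuous₂).comp
    (((continuous_simplexPointCLM q).comp continuous_snd).prodMk
      (hg.comp (continuous_simplexPoint q)))

theorem hasFDerivAt_setIntegral_simplexPoint {q : ℕ} {g g' : ℝ → ℂ}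
    (hg : ∀ u, HasDerivAt g (g' u) u) (hg' : Continuous g') (x : Fin (q + 1) → ℝ) :
    HasFDerivAt (fun y => ∫ t in orderedSimplex q, g (simplexPoint y t))
      (∫ t in orderedSimplex q, (simplexPointCLM t).smulRight (g' (simplexPoint x t))) x := by
  have hcont : Continuous g :=
    continuous_iff_continuousAt.2 fun u => (hg u).continuousAt
  have hx (y : Fin (q + 1) → ℝ) : Continuous fun t : Fin q → ℝ => g (simplexPoint y t) :=
    hcont.comp ((continuous_simplexPoint q).comp (continuous_const.prodMk continuous_id))
  have hF' : Continuous fun t : Fin q → ℝ =>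
      (simplexPointCLM t).smulRight (g' (simplexPoint x t)) :=
    Continuous.comp (g := fun p : (Fin (q + 1) → ℝ) × (Fin q → ℝ) =>
      (simplexPointCLM p.2).smulRight (g' (simplexPoint p.1 p.2))) (f := fun t => (x, t))
      (continuous_smulRight_simplexPoint hg') (continuous_const.prodMk continuous_id)
  have hcompact : IsCompact (Metric.closedBall x 1 ×ˢ orderedSimplex q) :=
    (isCompact_closedBall x 1).prod (isCompact_orderedSimplex q)
  obtain ⟨C, hC⟩ := hcompact.exists_bound_of_continuousOn
    (continuous_smulRight_simplexPoint hg').continuousOn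
  refine hasFDerivAt_integral_of_dominated_of_fderiv_le
    (F := fun y t => g (simplexPoint y t))
    (F' := fun y t => (simplexPointCLM t).smulRight (g' (simplexPoint y t)))
    (bound := fun _ => C) (Metric.closedBall_mem_nhds x one_pos)
    (Filter.Eventually.of_forall fun y => (hx y).aestronglyMeasurable)
    ((hx x).continuousOn.integrableOn_compact (isCompact_orderedSimplex q))
    hF'.aestronglyMeasurable ?_ ?_ ?_
  · filter_upwards [ae_restrict_mem (isCompact_orderedSimplex q).isClosed.measurableSet]
      with t ht y hy
    exact hC (y, t) ⟨hy, ht⟩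
  · exact continuousOn_const.integrableOn_compact (isCompact_orderedSimplex q)
  · exact Filter.Eventually.of_forall fun t y _ => hasFDerivAt_comp_simplexPoint hg t y

theorem setIntegral_smulRight_simplexPoint {q : ℕ} {g : ℝ → ℂ} (hg : Continuous g)
    (x : Fin (q + 1) → ℝ) :
    ∫ t in orderedSimplex q, (simplexPointCLM t).smulRight (g (simplexPoint x t)) =
      ∑ k : Fin (q + 1), (ContinuousLinearMap.proj k : (Fin (q + 1) → ℝ) →L[ℝ] ℝ).smulRight
        (∫ t in orderedSimplex (q + 1), g (simplexPoint (x ∘ k.predAbove) t)) := by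
  have hint : IntegrableOn (fun t : Fin q → ℝ =>
      (simplexPointCLM t).smulRight (g (simplexPoint x t))) (orderedSimplex q) :=
    ((continuous_smulRight_simplexPoint hg).comp
      (continuous_const.prodMk continuous_id)).continuousOn.integrableOn_compact
        (isCompact_orderedSimplex q)
  refine ContinuousLinearMap.ext fun v => ?_
  rw [ContinuousLinearMap.integral_apply hint]
  simp only [setIntegral_orderedSimplex_succ _ _ hg, simplexPointCLM_apply,
    ContinuousLinearMap.smulRight_apply, sum_apply,
    ContinuousLinearMap.proj_apply, ← integral_smul]
  rw [← integral_finsetSum]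
  · refine integral_congr_ae (Filter.Eventually.of_forall fun t => ?_)
    simp only [simplexPoint, Finset.sum_smul, Complex.real_smul, Complex.ofReal_mul]
    exact Finset.sum_congr rfl fun k _ => by ring
  · intro k _
    refine ContinuousOn.integrableOn_compact (isCompact_orderedSimplex q)
      (Continuous.continuousOn ?_)
    refine Continuous.const_smul (Continuous.mul (Complex.continuous_ofReal.comp ?_) ?_) _
    · exact ((continuous_apply _).comp (continuous_simplexTuple q)).sub
        ((continuous_apply _).comp (continuous_simplexTuple q))
    · exact hg.comp ((continuous_simplexPoint q).comp (continuous_const.prodMk continuous_id))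

theorem hasFDerivAt_GHdd (q : ℕ) {f : ℝ → ℂ} (hf : ContDiff ℝ (⊤ : ℕ∞) f)
    (x : Fin (q + 1) → ℝ) :
    HasFDerivAt (GHdd q f) (∑ k : Fin (q + 1),
      (ContinuousLinearMap.proj k : (Fin (q + 1) → ℝ) →L[ℝ] ℝ).smulRight
        (GHdd (q + 1) f (x ∘ k.predAbove))) x := by
  have hcont : Continuous (iteratedDeriv (q + 1) f) :=
    hf.continuous_iteratedDeriv (q + 1) (by exact_mod_cast le_top)
  have hderiv (u : ℝ) : HasDerivAt (iteratedDeriv q f) (iteratedDeriv (q + 1) f u) u := by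
    rw [iteratedDeriv_succ]
    exact (hf.differentiable_iteratedDeriv q
      (by exact_mod_cast ENat.natCast_lt_top q) u).hasDerivAt
  simp only [GHdd_eq_setIntegral (q + 1), ← setIntegral_smulRight_simplexPoint hcont]
  exact hasFDerivAt_setIntegral_simplexPoint hderiv hcont x

theorem pderiv'_GHdd_comp {m q : ℕ} {f : ℝ → ℂ} (hf : ContDiff ℝ (⊤ : ℕ∞) f) (a : ℂ)
    (σ : Fin (m + 1) → Fin q) (i : Fin q) (x : Fin q → ℝ) :
    pderiv' i (fun y => a * GHdd m f (y ∘ σ)) x =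
      a * ∑ k with σ k = i, GHdd (m + 1) f (x ∘ σ ∘ k.predAbove) := by
  set S : (Fin q → ℝ) →L[ℝ] (Fin (m + 1) → ℝ) :=
    ContinuousLinearMap.pi fun k => ContinuousLinearMap.proj (σ k) with hS
  have h : HasFDerivAt (fun y => GHdd m f (y ∘ σ)) _ x :=
    HasFDerivAt.comp (g := GHdd m f) x (hasFDerivAt_GHdd m hf (S x)) S.hasFDerivAt
  rw [pderiv', (h.const_mul a).fderiv]
  simp [hS, Finset.sum_filter, Pi.single_apply, ite_smul]
  exact Or.inl rfl

theorem card_fiber_comp_predAbove {m q : ℕ} (σ : Fin (m + 1) → Fin q) (k : Fin (m + 1))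
    (j : Fin q) :
    (Finset.univ.filter fun i => (σ ∘ k.predAbove) i = j).card =
      (Finset.univ.filter fun i => σ i = j).card + if σ k = j then 1 else 0 := by
  rw [Finset.card_filter, Finset.card_filter, Fin.sum_univ_succAbove _ k.castSucc, add_comm]
  simp [Fin.predAbove_succAbove]

theorem Monotone.eq_of_card_fiber_eq {m q : ℕ} {σ τ : Fin m → Fin q} (hσ : Monotone σ)
    (hτ : Monotone τ) (h : ∀ j, (Finset.univ.filter fun i => σ i = j).card =
      (Finset.univ.filter fun i => τ i = j).card) : σ = τ := by
  refine List.ofFn_injective (List.Perm.eq_of_sortedLE hσ.sortedLE_ofFn hτ.sortedLE_ofFn ?_)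
  rw [List.perm_iff_count]
  intro j
  have count (ρ : Fin m → Fin q) :
      (List.ofFn ρ).count j = (Finset.univ.filter fun i => ρ i = j).card := by
    simpa using (Fin.card_filter_univ_eq_vector_get_eq_count j (List.Vector.ofFn ρ)).symm
  rw [count, count, h]

theorem exists_pderiv'_eq {q : ℕ} {f : ℝ → ℂ} (hf : ContDiff ℝ (⊤ : ℕ∞) f)
    {β : Fin q → ℕ} {g : (Fin q → ℝ) → ℂ} (i : Fin q)
    (h : ∃ (m : ℕ) (σ : Fin (m + 1) → Fin q), Monotone σ ∧
      (∀ j, (Finset.univ.filter fun i => σ i = j).card = β j + 1) ∧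
      g = fun x => ((∏ j, (β j).factorial : ℕ) : ℂ) * GHdd m f (x ∘ σ)) :
    ∃ (m : ℕ) (σ : Fin (m + 1) → Fin q), Monotone σ ∧
      (∀ j, (Finset.univ.filter fun i => σ i = j).card = (β + Pi.single i 1 : Fin q → ℕ) j + 1) ∧
      pderiv' i g =
        fun x => ((∏ j, ((β + Pi.single i 1 : Fin q → ℕ) j).factorial : ℕ) : ℂ) * GHdd m f (x ∘ σ) := by
  obtain ⟨m, σ, hσ, hcard, rfl⟩ := h
  have hne : (Finset.univ.filter fun k => σ k = i).Nonempty := by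
    rw [← Finset.card_pos, hcard]; exact Nat.succ_pos _
  obtain ⟨k₀, hk₀⟩ := hne
  have hk₀ : σ k₀ = i := by simpa using hk₀
  have hmono (k : Fin (m + 1)) : Monotone (σ ∘ k.predAbove) :=
    hσ.comp (Fin.predAbove_right_monotone k)
  refine ⟨m + 1, σ ∘ k₀.predAbove, hmono k₀, fun j => ?_, ?_⟩
  · rw [card_fiber_comp_predAbove, hcard, hk₀, Pi.add_apply, Pi.single_apply]
    simp only [eq_comm (a := i)]
    ring
  · ext x
    rw [pderiv'_GHdd_comp hf, Finset.sum_congr rfl (g := fun _ =>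
      GHdd (m + 1) f (x ∘ σ ∘ k₀.predAbove)) fun k hk => ?_, Finset.sum_const, hcard]
    · have hprod : ∏ j, ((β + Pi.single i 1 : Fin q → ℕ) j).factorial =
          (∏ j, (β j).factorial) * (β i + 1) := by
        rw [← Finset.mul_prod_erase _ _ (Finset.mem_univ i),
          ← Finset.mul_prod_erase (a := i) Finset.univ (fun j => (β j).factorial)
            (Finset.mem_univ i),
          Finset.prod_congr rfl (g := fun j => (β j).factorial) fun j hj => by
            simp [Finset.ne_of_mem_erase hj]]
        simp only [Pi.add_apply, Pi.single_eq_same, Nat.factorial_succ]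
        ring
      rw [hprod, nsmul_eq_mul]
      push_cast
      ring
    · have hk : σ k = i := by simpa using hk
      rw [Monotone.eq_of_card_fiber_eq (hmono k) (hmono k₀) fun j => by
        rw [card_fiber_comp_predAbove, card_fiber_comp_predAbove, hk, hk₀]]

theorem exists_mderiv'_GHdd_eq {n : ℕ} {f : ℝ → ℂ} (hf : ContDiff ℝ (⊤ : ℕ∞) f)
    (α : Fin (n + 1) → ℕ) :
    ∃ (m : ℕ) (σ : Fin (m + 1) → Fin (n + 1)), Monotone σ ∧
      (∀ j, (Finset.univ.filter fun i => σ i = j).card = α j + 1) ∧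
      mderiv' α (GHdd n f) =
        fun x => ((∏ j, (α j).factorial : ℕ) : ℂ) * GHdd m f (x ∘ σ) := by
  set P : (Fin (n + 1) → ℕ) → ((Fin (n + 1) → ℝ) → ℂ) → Prop := fun β g =>
    ∃ (m : ℕ) (σ : Fin (m + 1) → Fin (n + 1)), Monotone σ ∧
      (∀ j, (Finset.univ.filter fun i => σ i = j).card = β j + 1) ∧
      g = fun x => ((∏ j, (β j).factorial : ℕ) : ℂ) * GHdd m f (x ∘ σ) with hP
  have hiter (i : Fin (n + 1)) (a : ℕ) {β g} (h : P β g) :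
      P (β + Pi.single i a) ((pderiv' i)^[a] g) := by
    induction a with
    | zero => simpa using h
    | succ a ih =>
      rw [Function.iterate_succ_apply', Pi.single_add, ← add_assoc]
      exact exists_pderiv'_eq hf i ih
  have hlist (l : List (Fin (n + 1))) :
      P (l.map fun i => Pi.single i (α i)).sum
        (((l.map fun i => (pderiv' i)^[α i]).foldr (· ∘ ·) id) (GHdd n f)) := by
    induction l with
    | nil => exact ⟨n, id, monotone_id, fun j => by simp [Finset.filter_eq'], by simp⟩
    | cons i l ih =>
      simp only [List.map_cons, List.sum_cons, List.foldr_cons, Function.comp_apply]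
      rw [add_comm]
      exact hiter i (α i) ih
  have hsum : ((List.finRange (n + 1)).map fun i => (Pi.single i (α i) : Fin (n + 1) → ℕ)).sum
      = α := by
    rw [← List.ofFn_eq_map, List.sum_ofFn]
    exact Finset.univ_sum_single α
  have := hlist (List.finRange (n + 1))
  rwa [hsum, ← List.ofFn_eq_map] at this

/-- **Confluent divided differences as derivatives.** For a smooth `f`, pairwise distinct
`x₀,…,xₙ` and a multiindex `α`, the divided difference `[x₀^{α₀+1},…,xₙ^{αₙ+1}]f` with `x_j`
repeated `α_j+1` times (realised as `D_{|α|+n} f (x ∘ σ)` for a monotone `σ` whose fibre over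
`j` has `α_j + 1` elements) equals `(1/α!) ∂^α_x (D_n f (x₀,…,xₙ))`. -/
theorem stmt9 {n : ℕ} (hn : 1 ≤ n) (f : ℝ → ℂ) (hf : ContDiff ℝ (⊤ : ℕ∞) f)
    (x : Fin (n+1) → ℝ) (hinj : Function.Injective x)
    (α : Fin (n+1) → ℕ)
    (σ : Fin ((∑ j, α j) + n + 1) → Fin (n+1)) (hσ : Monotone σ)
    (hcard : ∀ j, (Finset.univ.filter (fun i => σ i = j)).card = α j + 1) :
    GHdd ((∑ j, α j) + n) f (x ∘ σ)
      = (1 / ((∏ j, (α j).factorial : ℕ) : ℂ)) * mderiv' α (GHdd n f) x := by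
  obtain ⟨m, τ, hτ, hτcard, h⟩ := exists_mderiv'_GHdd_eq hf α
  obtain rfl : m = (∑ j, α j) + n := by
    have h1 := Finset.card_eq_sum_card_fiberwise (f := τ) (s := Finset.univ)
      (t := Finset.univ) fun _ _ => Finset.mem_coe.2 (Finset.mem_univ _)
    simp only [hτcard, Finset.sum_add_distrib] at h1
    simp at h1
    omega
  obtain rfl : σ = τ := hσ.eq_of_card_fiber_eq hτ fun j => by rw [hcard, hτcard]
  have hne : ((∏ j, (α j).factorial : ℕ) : ℂ) ≠ 0 :=
    Nat.cast_ne_zero.2 (Finset.prod_ne_zero_iff.2 fun j _ => Nat.factorial_ne_zero _)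
  rw [h, one_div, inv_mul_cancel_left₀ hne]
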